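/- arXiv:2202.07821 — 6 statements merged into one kernel-verified Lean document; each statement's English description precedes it below -/
import Mathlib

section
/- Let p1, p2 ∈ S⁺_n with p1 ≤ p2 in the Loewner order. Then the order interval [p1,p2] = {p ∈ S⁺_n : p1 ≤ p ≤ p2} is geodesically convex: for all p, q ∈ S⁺_n with p1 ≤ p ≤ p2 and p1 ≤ q ≤ p2, and all θ ∈ [0,1], one has p1 ≤ p #_θ q ≤ p2. -/
open Matrix Real Filter

namespace SPD

variable {n : ℕ}

/-- Apply a real function to a symmetric matrix via the spectral calculus
(junk value `0` on non-Hermitian input). -/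
noncomputable def mfun (p : Matrix (Fin n) (Fin n) ℝ) (f : ℝ → ℝ) : Matrix (Fin n) (Fin n) ℝ :=
  if hp : p.IsHermitian then hp.cfc f else 0

/-- The positive definite square root. -/
noncomputable def msqrt (p : Matrix (Fin n) (Fin n) ℝ) : Matrix (Fin n) (Fin n) ℝ :=
  mfun p Real.sqrt

/-- The eigenvalues of a symmetric matrix (junk value `0` on non-Hermitian input). -/
noncomputable def eigs (p : Matrix (Fin n) (Fin n) ℝ) : Fin n → ℝ :=
  if hp : p.IsHermitian then hp.eigenvalues else 0

/-- The Loewner order: `p ≤ q` iff `q - p` is positive semidefinite. -/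
def Loewner (p q : Matrix (Fin n) (Fin n) ℝ) : Prop := (q - p).PosSemidef

/-- The Riemannian (trace-metric) distance on positive definite matrices:
`d(p,q) = (∑ i, (ln λ_i(p^{-1/2} q p^{-1/2}))²)^{1/2}`. -/
noncomputable def dR (p q : Matrix (Fin n) (Fin n) ℝ) : ℝ :=
  Real.sqrt (∑ i, (Real.log (eigs ((msqrt p)⁻¹ * q * (msqrt p)⁻¹) i)) ^ 2)

/-- The θ-weighted geometric mean `p #_θ q = p^{1/2} (p^{-1/2} q p^{-1/2})^θ p^{1/2}`. -/
noncomputable def gmean (θ : ℝ) (p q : Matrix (Fin n) (Fin n) ℝ) : Matrix (Fin n) (Fin n) ℝ :=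
  msqrt p * mfun ((msqrt p)⁻¹ * q * (msqrt p)⁻¹) (fun x => x ^ θ) * msqrt p

/-- The singular values of a matrix in decreasing order: `svals M i` is `α_{i+1}(M)`,
so `svals M ⟨0,_⟩ = α₁(M) ≥ … ≥ svals M ⟨n-1,_⟩ = α_n(M)`. -/
noncomputable def svals (M : Matrix (Fin n) (Fin n) ℝ) : Fin n → ℝ := fun i =>
  Real.sqrt ((eigs (Mᵀ * M) ∘ Tuple.sort (eigs (Mᵀ * M))) i.rev)

/-- The operator (spectral) norm: the largest singular value. -/
noncomputable def opNorm (M : Matrix (Fin n) (Fin n) ℝ) : ℝ :=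
  if h : 0 < n then svals M ⟨0, h⟩ else 0

/-- The trace-metric inner product `⟨u,v⟩_p = tr(p⁻¹ u p⁻¹ v)`. -/
noncomputable def minner (p u v : Matrix (Fin n) (Fin n) ℝ) : ℝ :=
  (p⁻¹ * u * p⁻¹ * v).trace

/-- The trace-metric norm `‖v‖_p`. -/
noncomputable def mnorm (p v : Matrix (Fin n) (Fin n) ℝ) : ℝ :=
  Real.sqrt (minner p v v)

/-- The Riemannian exponential `exp_p(v) = p^{1/2} exp(p^{-1/2} v p^{-1/2}) p^{1/2}`. -/
noncomputable def mexpP (p v : Matrix (Fin n) (Fin n) ℝ) : Matrix (Fin n) (Fin n) ℝ :=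
  msqrt p * mfun ((msqrt p)⁻¹ * v * (msqrt p)⁻¹) Real.exp * msqrt p

/-- The Riemannian logarithm `log_p(q) = p^{1/2} log(p^{-1/2} q p^{-1/2}) p^{1/2}`. -/
noncomputable def mlogP (p q : Matrix (Fin n) (Fin n) ℝ) : Matrix (Fin n) (Fin n) ℝ :=
  msqrt p * mfun ((msqrt p)⁻¹ * q * (msqrt p)⁻¹) Real.log * msqrt p

/-- `s` is a subgradient of `f` at `p`:  `f(q) ≥ f(p) + ⟨s, log_p q⟩_p` for all `q ∈ S⁺_n`. -/
def IsSubgrad (f : Matrix (Fin n) (Fin n) ℝ → ℝ) (p s : Matrix (Fin n) (Fin n) ℝ) : Prop :=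
  s.IsHermitian ∧ ∀ q : Matrix (Fin n) (Fin n) ℝ, q.PosDef → f p + minner p s (mlogP p q) ≤ f q

/-- Geodesic convexity of a function on `S⁺_n`. -/
def GConvexFun (f : Matrix (Fin n) (Fin n) ℝ → ℝ) : Prop :=
  ∀ p q : Matrix (Fin n) (Fin n) ℝ, p.PosDef → q.PosDef → ∀ θ ∈ Set.Icc (0:ℝ) 1,
    f (gmean θ p q) ≤ (1 - θ) * f p + θ * f q

/-- Geodesic convexity of a subset of `S⁺_n`. -/
def GConvexSet (X : Set (Matrix (Fin n) (Fin n) ℝ)) : Prop :=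
  ∀ p ∈ X, ∀ q ∈ X, ∀ θ ∈ Set.Icc (0:ℝ) 1, gmean θ p q ∈ X

/-- `κ̂ = 1/√2`, the square root of the absolute value of the curvature lower bound `-1/2`. -/
noncomputable def khat : ℝ := (Real.sqrt 2)⁻¹

/-- The inexact projected subgradient iteration: `p₀ ∈ X`; `v_k = s_k + u_k ≠ 0` with
`s_k ∈ ∂f(p_k)` and symmetric error `u_k`; `p̃_{k+1} = exp_{p_k}(−t_k·v_k/‖v_k‖_{p_k})`;
and `p_{k+1} ∈ X` is a nearest point of `X` to `p̃_{k+1}` w.r.t. `d`. -/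
structure Iter (f : Matrix (Fin n) (Fin n) ℝ → ℝ) (X : Set (Matrix (Fin n) (Fin n) ℝ))
    (p s u : ℕ → Matrix (Fin n) (Fin n) ℝ) (t : ℕ → ℝ) : Prop where
  p0_mem : p 0 ∈ X
  subgrad : ∀ k, IsSubgrad f (p k) (s k)
  u_herm : ∀ k, (u k).IsHermitian
  v_ne : ∀ k, s k + u k ≠ 0
  proj_mem : ∀ k, p (k + 1) ∈ X
  proj_nearest : ∀ k, ∀ q ∈ X,
    dR (mexpP (p k) (-(t k / mnorm (p k) (s k + u k)) • (s k + u k))) (p (k + 1)) ≤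
      dR (mexpP (p k) (-(t k / mnorm (p k) (s k + u k)) • (s k + u k))) q

end SPD

open SPD

section aux
open scoped MatrixOrder ComplexOrder
open scoped Matrix.Norms.L2Operator

/-- Complexification of real matrices as a star algebra homomorphism. -/
noncomputable def cplx (n : ℕ) : Matrix (Fin n) (Fin n) ℝ →⋆ₐ[ℝ] Matrix (Fin n) (Fin n) ℂ :=
  { (Complex.ofRealAm).mapMatrix (m := Fin n) with
    map_star' := by
      intro A
      ext i j
      simp [Matrix.star_apply] }

lemma cplx_apply {n : ℕ} (A : Matrix (Fin n) (Fin n) ℝ) (i j : Fin n) :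
    cplx n A i j = (A i j : ℂ) := rfl

lemma cplx_continuous (n : ℕ) : Continuous (cplx n) := by
  refine continuous_matrix fun i j => ?_
  simp only [cplx_apply]
  fun_prop

lemma cplx_nonneg {n : ℕ} {A : Matrix (Fin n) (Fin n) ℝ} (hA : A.PosSemidef) :
    (cplx n A).PosSemidef := by
  obtain ⟨B, rfl⟩ := CStarAlgebra.nonneg_iff_eq_star_mul_self.mp hA.nonneg
  rw [map_mul, map_star]
  exact posSemidef_conjTranspose_mul_self _

lemma cplx_reflect {n : ℕ} {A : Matrix (Fin n) (Fin n) ℝ} (hA : (cplx n A).PosSemidef) :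
    A.PosSemidef := by
  refine PosSemidef.of_dotProduct_mulVec_nonneg ?_ ?_
  · ext i j
    have := hA.1.apply i j
    simp only [cplx_apply] at this
    simpa using this
  · intro x
    have := hA.dotProduct_mulVec_nonneg (fun i => (x i : ℂ))
    have h2 : star (fun i => (x i : ℂ)) ⬝ᵥ (cplx n A *ᵥ fun i => (x i : ℂ))
        = ((star x ⬝ᵥ (A *ᵥ x) : ℝ) : ℂ) := by
      simp [dotProduct, mulVec, cplx_apply]
    rw [h2] at this
    exact_mod_cast this

lemma rpow_mono_aux {n : ℕ} {A B : Matrix (Fin n) (Fin n) ℝ} (hA : A.PosSemidef)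
    (hB : B.PosSemidef) (hAB : (B - A).PosSemidef) {θ : ℝ} (hθ : θ ∈ Set.Icc (0:ℝ) 1) :
    (cfc (fun x : ℝ => x ^ θ) B - cfc (fun x : ℝ => x ^ θ) A).PosSemidef := by
  have hc : Continuous (fun x : ℝ => x ^ θ) := Real.continuous_rpow_const hθ.1
  have key : ∀ C : Matrix (Fin n) (Fin n) ℝ, C.PosSemidef →
      cplx n (cfc (fun x : ℝ => x ^ θ) C) = (cplx n C) ^ θ := by
    intro C hC
    rw [CFC.rpow_eq_cfc_real (cplx_nonneg hC).nonneg]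
    exact StarAlgHom.map_cfc (cplx n) _ C hc.continuousOn (cplx_continuous n) hC.1
      (cplx_nonneg hC).1
  apply cplx_reflect
  rw [map_sub, key A hA, key B hB]
  have h : cplx n A ≤ cplx n B := by
    rw [Matrix.le_iff, ← map_sub]
    exact cplx_nonneg hAB
  exact CFC.rpow_le_rpow hθ h

lemma mfun_eq {n : ℕ} {A : Matrix (Fin n) (Fin n) ℝ} (hA : A.IsHermitian) (f : ℝ → ℝ) :
    mfun A f = cfc f A := by
  rw [mfun, dif_pos hA, hA.cfc_eq]

lemma le_rpow_of_le_one {n : ℕ} {C : Matrix (Fin n) (Fin n) ℝ} (hC : C.PosSemidef)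
    (hC1 : (1 - C).PosSemidef) {θ : ℝ} (hθ : θ ∈ Set.Icc (0:ℝ) 1) :
    C ≤ cfc (fun x : ℝ => x ^ θ) C := by
  have hc : Continuous (fun x : ℝ => x ^ θ) := Real.continuous_rpow_const hθ.1
  have hs : IsSelfAdjoint C := hC.1
  have h1 : ∀ x ∈ spectrum ℝ C, x ≤ 1 := by
    have : C ≤ algebraMap ℝ _ 1 := by rw [map_one]; exact hC1
    exact (le_algebraMap_iff_spectrum_le (a := C) hs).mp this
  have h0 : ∀ x ∈ spectrum ℝ C, 0 ≤ x := fun x hx => spectrum_nonneg_of_nonneg hC.nonneg hx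
  conv_lhs => rw [← cfc_id ℝ C hs]
  refine cfc_mono (fun x hx => ?_) continuousOn_id hc.continuousOn
  rcases (h0 x hx).eq_or_lt with h | h
  · simp only [id, ← h]
    exact Real.rpow_nonneg le_rfl _
  · simpa using Real.rpow_le_rpow_of_exponent_ge h (h1 x hx) hθ.2

lemma rpow_le_of_one_le {n : ℕ} {C : Matrix (Fin n) (Fin n) ℝ} (hC : C.IsHermitian)
    (hC1 : (C - 1).PosSemidef) {θ : ℝ} (hθ : θ ∈ Set.Icc (0:ℝ) 1) :
    cfc (fun x : ℝ => x ^ θ) C ≤ C := by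
  have hc : Continuous (fun x : ℝ => x ^ θ) := Real.continuous_rpow_const hθ.1
  have hs : IsSelfAdjoint C := hC
  have h1 : ∀ x ∈ spectrum ℝ C, 1 ≤ x := by
    have : algebraMap ℝ _ 1 ≤ C := by rw [map_one]; exact hC1
    exact (algebraMap_le_iff_le_spectrum (a := C) hs).mp this
  conv_rhs => rw [← cfc_id ℝ C hs]
  refine cfc_mono (fun x hx => ?_) hc.continuousOn continuousOn_id
  simpa using Real.rpow_le_rpow_of_exponent_le (h1 x hx) hθ.2

lemma msqrt_facts {n : ℕ} {p : Matrix (Fin n) (Fin n) ℝ} (hp : p.PosDef) :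
    (msqrt p).IsHermitian ∧ msqrt p * msqrt p = p ∧ IsUnit (msqrt p).det := by
  have hs : IsSelfAdjoint p := hp.1
  have hmul : msqrt p * msqrt p = p := by
    rw [msqrt, mfun_eq hp.1, ← cfc_mul _ _ p Real.continuous_sqrt.continuousOn
      Real.continuous_sqrt.continuousOn]
    conv_rhs => rw [← cfc_id ℝ p hs]
    refine cfc_congr fun x hx => ?_
    exact Real.mul_self_sqrt (spectrum_nonneg_of_nonneg hp.posSemidef.nonneg hx)
  refine ⟨?_, hmul, ?_⟩
  · rw [msqrt, mfun_eq hp.1]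
    exact cfc_predicate (R := ℝ) Real.sqrt p
  · have h := (Matrix.isUnit_iff_isUnit_det _).mp hp.isUnit
    rw [← hmul, det_mul] at h
    exact isUnit_of_mul_isUnit_left h

end aux

/-- Order intervals in `S⁺_n` are geodesically convex. -/
theorem order_interval_geodesically_convex {n : ℕ}
    (p1 p2 : Matrix (Fin n) (Fin n) ℝ) (hp1 : p1.PosDef) (hp2 : p2.PosDef)
    (h12 : Loewner p1 p2)
    (p q : Matrix (Fin n) (Fin n) ℝ) (hp : p.PosDef) (hq : q.PosDef)
    (hp_lo : Loewner p1 p) (hp_hi : Loewner p p2)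
    (hq_lo : Loewner p1 q) (hq_hi : Loewner q p2)
    (θ : ℝ) (hθ : θ ∈ Set.Icc (0:ℝ) 1) :
    Loewner p1 (gmean θ p q) ∧ Loewner (gmean θ p q) p2 := by
  obtain ⟨hS, hSS, hu⟩ := msqrt_facts hp
  unfold Loewner at *
  unfold gmean
  set S := msqrt p with hSdef
  have hi : (S⁻¹).IsHermitian := hS.inv
  have hl : S * S⁻¹ = 1 := mul_nonsing_inv S hu
  have hr : S⁻¹ * S = 1 := nonsing_inv_mul S hu
  have conj_pos : ∀ X : Matrix (Fin n) (Fin n) ℝ, X.PosSemidef →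
      (S⁻¹ * X * S⁻¹).PosSemidef := by
    intro X hX
    have := hX.conjTranspose_mul_mul_same S⁻¹
    rwa [hi.eq] at this
  have conj_pos' : ∀ X : Matrix (Fin n) (Fin n) ℝ, X.PosSemidef →
      (S * X * S).PosSemidef := by
    intro X hX
    have := hX.conjTranspose_mul_mul_same S
    rwa [hS.eq] at this
  have conj_sub : ∀ X Y : Matrix (Fin n) (Fin n) ℝ, (X - Y).PosSemidef →
      (S⁻¹ * X * S⁻¹ - S⁻¹ * Y * S⁻¹).PosSemidef := by
    intro X Y h
    have := conj_pos _ h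
    rwa [mul_sub, sub_mul] at this
  have back : ∀ X : Matrix (Fin n) (Fin n) ℝ, S * (S⁻¹ * X * S⁻¹) * S = X := by
    intro X
    calc S * (S⁻¹ * X * S⁻¹) * S = (S * S⁻¹) * X * (S⁻¹ * S) := by simp only [mul_assoc]
      _ = X := by rw [hl, hr, one_mul, mul_one]
  have hone : S⁻¹ * p * S⁻¹ = 1 := by
    rw [← hSS]
    calc S⁻¹ * (S * S) * S⁻¹ = (S⁻¹ * S) * (S * S⁻¹) := by simp only [mul_assoc]
      _ = 1 := by rw [hl, hr, one_mul]
  have hA := conj_pos q hq.posSemidef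
  have hC := conj_pos p1 hp1.posSemidef
  have hD := conj_pos p2 hp2.posSemidef
  rw [mfun_eq hA.1]
  have lo1 := conj_sub _ _ hp_lo
  have hi1 := conj_sub _ _ hp_hi
  rw [hone] at lo1 hi1
  have lo2 := rpow_mono_aux hC hA (conj_sub _ _ hq_lo) hθ
  have hi2 := rpow_mono_aux hA hD (conj_sub _ _ hq_hi) hθ
  have lo3 := conj_pos' _ (lo2.add (Matrix.le_iff.mp (le_rpow_of_le_one hC lo1 hθ)))
  have hi3 := conj_pos' _ ((Matrix.le_iff.mp (rpow_le_of_one_le hD.1 hi1 hθ)).add hi2)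
  rw [sub_add_sub_cancel, mul_sub, sub_mul, back] at lo3 hi3
  exact ⟨lo3, hi3⟩
end

section
/- Let p1, p, p2 ∈ S⁺_n with p1 ≤ p ≤ p2 in the Loewner order. Then ∑_{i=1}^n (ln λ_i(p))² ≤ ∑_{i=1}^n (ln λ_i(p1))² + ∑_{i=1}^n (ln λ_i(p2))²; equivalently, d(p,I)² ≤ d(p1,I)² + d(p2,I)², where I is the identity matrix. -/
open Matrix Real Filter

open SPD


theorem quad_eq {n : ℕ} {A : Matrix (Fin n) (Fin n) ℝ} (hA : A.IsHermitian) :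
    ∃ L : (Fin n → ℝ) →ₗ[ℝ] (Fin n → ℝ), (∀ x, x ⬝ᵥ x = ∑ i, L x i ^ 2) ∧
      ∀ x, x ⬝ᵥ (A *ᵥ x) = ∑ i, hA.eigenvalues i * L x i ^ 2 := by
  set U : Matrix (Fin n) (Fin n) ℝ := (hA.eigenvectorUnitary : Matrix (Fin n) (Fin n) ℝ) with hU
  have hUU : U * Uᵀ = 1 := by
    have := Unitary.coe_mul_star_self hA.eigenvectorUnitary
    simpa [star_eq_conjTranspose] using this
  have hs : A = U * diagonal hA.eigenvalues * Uᵀ := by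
    have := hA.spectral_theorem
    rw [Unitary.conjStarAlgAut_apply] at this
    simpa [star_eq_conjTranspose] using this
  have key : ∀ (d : Fin n → ℝ) (x : Fin n → ℝ),
      x ⬝ᵥ ((U * diagonal d * Uᵀ) *ᵥ x) = ∑ i, d i * (Uᵀ *ᵥ x) i ^ 2 := by
    intro d x
    rw [← mulVec_mulVec, ← mulVec_mulVec, dotProduct_mulVec, ← mulVec_transpose]
    simp only [dotProduct, mulVec_diagonal]
    exact Finset.sum_congr rfl fun i _ => by ring
  refine ⟨Matrix.toLin' Uᵀ, fun x => ?_, fun x => ?_⟩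
  · have := key 1 x
    simpa [hUU] using this
  · conv_lhs => rw [hs]
    simpa using key hA.eigenvalues x

theorem weyl_mono {n : ℕ} {A B : Matrix (Fin n) (Fin n) ℝ} (hA : A.IsHermitian)
    (hB : B.IsHermitian) (h : (B - A).PosSemidef) (k : Fin n) :
    hA.eigenvalues k ≤ hB.eigenvalues k := by
  obtain ⟨L, hL1, hL2⟩ := quad_eq hA
  obtain ⟨M, hM1, hM2⟩ := quad_eq hB
  let e : Fin (Fintype.card (Fin n)) ≃ Fin n := Fintype.equivOfCardEq (Fintype.card_fin _)
  have hAa : ∀ i j, e.symm i ≤ e.symm j → hA.eigenvalues j ≤ hA.eigenvalues i :=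
    fun i j hij => hA.eigenvalues₀_antitone hij
  have hBa : ∀ i j, e.symm i ≤ e.symm j → hB.eigenvalues j ≤ hB.eigenvalues i :=
    fun i j hij => hB.eigenvalues₀_antitone hij
  let T : (Fin n → ℝ) →ₗ[ℝ] ({i : Fin n // i ≠ k} → ℝ) :=
    LinearMap.pi fun i => if e.symm k < e.symm i.1
      then (LinearMap.proj i.1) ∘ₗ L else (LinearMap.proj i.1) ∘ₗ M
  have hT : LinearMap.ker T ≠ ⊥ := by
    apply LinearMap.ker_ne_bot_of_finrank_lt
    have : 0 < n := k.pos
    simp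
    omega
  obtain ⟨x, hx, hx0⟩ := (Submodule.ne_bot_iff _).1 hT
  have hTx : ∀ i (hi : i ≠ k), T x ⟨i, hi⟩ = 0 := fun i hi => by
    rw [LinearMap.mem_ker.1 hx]; rfl
  have hLx : ∀ i, e.symm k < e.symm i → L x i = 0 := fun i hi => by
    have h1 : i ≠ k := by rintro rfl; exact lt_irrefl _ hi
    simpa [T, hi] using hTx i h1
  have hMx : ∀ i, e.symm i < e.symm k → M x i = 0 := fun i hi => by
    have h1 : i ≠ k := by rintro rfl; exact lt_irrefl _ hi
    have := hTx i h1
    simp only [T, LinearMap.pi_apply, if_neg (not_lt.2 hi.le)] at this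
    exact this
  have hpos : 0 < x ⬝ᵥ x := by
    have := dotProduct_star_self_pos_iff.2 hx0
    simpa using this
  have hle : x ⬝ᵥ (A *ᵥ x) ≤ x ⬝ᵥ (B *ᵥ x) := by
    have := h.dotProduct_mulVec_nonneg x
    simp only [star_trivial, sub_mulVec, dotProduct_sub] at this
    linarith
  have h1 : hA.eigenvalues k * (x ⬝ᵥ x) ≤ x ⬝ᵥ (A *ᵥ x) := by
    rw [hL1, hL2, Finset.mul_sum]
    refine Finset.sum_le_sum fun i _ => ?_
    by_cases hi : e.symm k < e.symm i
    · simp [hLx i hi]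
    · exact mul_le_mul_of_nonneg_right (hAa _ _ (not_lt.1 hi)) (sq_nonneg _)
  have h2 : x ⬝ᵥ (B *ᵥ x) ≤ hB.eigenvalues k * (x ⬝ᵥ x) := by
    rw [hM1, hM2, Finset.mul_sum]
    refine Finset.sum_le_sum fun i _ => ?_
    by_cases hi : e.symm i < e.symm k
    · simp [hMx i hi]
    · exact mul_le_mul_of_nonneg_right (hBa _ _ (not_lt.1 hi)) (sq_nonneg _)
  exact le_of_mul_le_mul_right (h1.trans (hle.trans h2)) hpos

theorem dR_one_sq {n : ℕ} {p : Matrix (Fin n) (Fin n) ℝ} (hp : p.PosDef) :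
    dR p 1 ^ 2 = ∑ i, (Real.log (eigs p i)) ^ 2 := by
  have hH : p.IsHermitian := hp.1
  have hsa : IsSelfAdjoint p := hH
  have hspec : ∀ x ∈ spectrum ℝ p, 0 < x := by
    intro x hx
    rw [hH.spectrum_real_eq_range_eigenvalues] at hx
    obtain ⟨i, rfl⟩ := hx
    exact hp.eigenvalues_pos i
  have hcont : ∀ f : ℝ → ℝ, ContinuousOn f (spectrum ℝ p) := fun f => by
    rw [continuousOn_iff_continuous_domRestrict]; fun_prop
  have hS : msqrt p = cfc Real.sqrt p := by
    rw [msqrt, mfun, dif_pos hH, hH.cfc_eq]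
  have hSS : msqrt p * msqrt p = p := by
    rw [hS, ← cfc_mul _ _ p (hcont _) (hcont _)]
    conv_rhs => rw [← cfc_id ℝ p]
    exact cfc_congr fun x hx => Real.mul_self_sqrt (hspec x hx).le
  have hpi : p * cfc (fun x : ℝ => x⁻¹) p = 1 := by
    have h1 : p * cfc (fun x : ℝ => x⁻¹) p = cfc (id : ℝ → ℝ) p * cfc (fun x : ℝ => x⁻¹) p := by
      rw [cfc_id ℝ p]
    rw [h1, ← cfc_mul _ _ p (hcont _) (hcont _), ← cfc_one ℝ p]
    exact cfc_congr fun x hx => mul_inv_cancel₀ (hspec x hx).ne'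
  have hM : (msqrt p)⁻¹ * 1 * (msqrt p)⁻¹ = cfc (fun x : ℝ => x⁻¹) p := by
    rw [mul_one, ← Matrix.mul_inv_rev, hSS]
    exact Matrix.inv_eq_right_inv hpi
  have hMH : (cfc (fun x : ℝ => x⁻¹) p).IsHermitian := (cfc_predicate _ p : IsSelfAdjoint _)
  rw [dR, Real.sq_sqrt (Finset.sum_nonneg fun i _ => sq_nonneg _), hM, eigs, eigs, dif_pos hMH,
    dif_pos hH]
  have hr : (Finset.univ.val.map hMH.eigenvalues) =
      Finset.univ.val.map (fun i => (hH.eigenvalues i)⁻¹) := by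
    have h1 := hMH.roots_charpoly_eq_eigenvalues
    rw [hH.charpoly_cfc_eq, Polynomial.roots_prod _ _
      (by simp [Finset.prod_ne_zero_iff, Polynomial.X_sub_C_ne_zero])] at h1
    simpa [Function.comp_def] using h1.symm
  have h2 := congrArg (fun s => (s.map fun x => Real.log x ^ 2).sum) hr
  simpa [Multiset.map_map, Function.comp_def, List.sum_ofFn] using h2

/-- If `p1 ≤ p ≤ p2` then `∑ (ln λ_i(p))² ≤ ∑ (ln λ_i(p1))² + ∑ (ln λ_i(p2))²`,
i.e. `d(p,I)² ≤ d(p1,I)² + d(p2,I)²`. -/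
theorem dist_to_id_sq_le_of_order {n : ℕ}
    (p1 p p2 : Matrix (Fin n) (Fin n) ℝ)
    (hp1 : p1.PosDef) (hp : p.PosDef) (hp2 : p2.PosDef)
    (h1 : Loewner p1 p) (h2 : Loewner p p2) :
    (∑ i, (Real.log (eigs p i)) ^ 2
        ≤ ∑ i, (Real.log (eigs p1 i)) ^ 2 + ∑ i, (Real.log (eigs p2 i)) ^ 2)
    ∧ dR p 1 ^ 2 ≤ dR p1 1 ^ 2 + dR p2 1 ^ 2 := by
  have hmain : ∑ i, (Real.log (eigs p i)) ^ 2
        ≤ ∑ i, (Real.log (eigs p1 i)) ^ 2 + ∑ i, (Real.log (eigs p2 i)) ^ 2 := by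
    rw [← Finset.sum_add_distrib]
    refine Finset.sum_le_sum fun i _ => ?_
    simp only [eigs, dif_pos hp.1, dif_pos hp1.1, dif_pos hp2.1]
    have a1 := Real.log_le_log (hp1.eigenvalues_pos i) (weyl_mono hp1.1 hp.1 h1 i)
    have a2 := Real.log_le_log (hp.eigenvalues_pos i) (weyl_mono hp.1 hp2.1 h2 i)
    rcases le_total 0 (Real.log (hp.1.eigenvalues i)) with h0 | h0 <;> nlinarith
  refine ⟨hmain, ?_⟩
  rw [dR_one_sq hp, dR_one_sq hp1, dR_one_sq hp2]
  exact hmain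
end

section
/- Let 0 < α < β, let p ∈ S⁺_n, and write p = Uᵀ diag(γ₁,…,γ_n) U with U orthogonal and γ₁ ≥ … ≥ γ_n > 0. Define q* := Uᵀ diag(ζ₁,…,ζ_n) U, where ζ_i = α if γ_i < α, ζ_i = γ_i if γ_i ∈ [α,β], and ζ_i = β if γ_i > β. Then αI ≤ q* ≤ βI, and for every q ∈ S⁺_n with αI ≤ q ≤ βI one has d(p,q*) ≤ d(p,q); that is, q* is a nearest point to p in the order interval [αI,βI] with respect to d. -/
open Matrix Real Filter

open SPD

lemma core_scalar {n : ℕ} (α β : ℝ) (hα : 0 < α) (hαβ : α < β)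
    (C : Matrix (Fin n) (Fin n) ℝ) (h1 : C * Cᵀ = 1) (h2 : Cᵀ * C = 1)
    (l γ : Fin n → ℝ) (hl : ∀ i, 0 < l i) (hγ : ∀ i, 0 < γ i)
    (hb : ∀ i, ∑ j, C i j ^ 2 * l j ≤ β / γ i)
    (ha : ∀ i, ∑ j, C i j ^ 2 * (l j)⁻¹ ≤ γ i / α) :
    ∑ i, (Real.log (min β (max α (γ i)) / γ i)) ^ 2 ≤ ∑ j, (Real.log (l j)) ^ 2 := by
  have row : ∀ i, ∑ j, C i j ^ 2 = 1 := by
    intro i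
    have := congrFun (congrFun h1 i) i
    simpa [Matrix.mul_apply, sq] using this
  have col : ∀ j, ∑ i, C i j ^ 2 = 1 := by
    intro i
    have := congrFun (congrFun h2 i) i
    simpa [Matrix.mul_apply, sq] using this
  have jen : ∀ (m : Fin n → ℝ) (_ : ∀ i, 0 < m i) (i : Fin n),
      ∑ j, C i j ^ 2 * Real.log (m j) ≤ Real.log (∑ j, C i j ^ 2 * m j) := by
    intro m hm i
    have := strictConcaveOn_log_Ioi.concaveOn.le_map_sum (t := Finset.univ)
      (w := fun j => C i j ^ 2) (p := m) (fun j _ => sq_nonneg _) (row i) (fun j _ => hm j)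
    simpa using this
  have pos : ∀ (m : Fin n → ℝ) (_ : ∀ i, 0 < m i) (i : Fin n), 0 < ∑ j, C i j ^ 2 * m j := by
    intro m hm i
    refine lt_of_le_of_ne (Finset.sum_nonneg fun j _ => mul_nonneg (sq_nonneg _) (hm j).le) ?_
    intro h
    have h0 := (Finset.sum_eq_zero_iff_of_nonneg
      (fun j _ => mul_nonneg (sq_nonneg (C i j)) (hm j).le)).1 h.symm
    have : ∑ j, C i j ^ 2 = 0 := Finset.sum_eq_zero fun j hj => by
      rcases mul_eq_zero.1 (h0 j hj) with h | h
      · exact h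
      · exact absurd h (hm j).ne'
    rw [row i] at this
    exact one_ne_zero this
  have up : ∀ i, ∑ j, C i j ^ 2 * Real.log (l j) ≤ Real.log (β / γ i) := fun i =>
    (jen l hl i).trans (Real.log_le_log (pos l hl i) (hb i))
  have lo : ∀ i, Real.log (α / γ i) ≤ ∑ j, C i j ^ 2 * Real.log (l j) := by
    intro i
    have hl' : ∀ i, 0 < (l i)⁻¹ := fun i => inv_pos.2 (hl i)
    have := (jen (fun j => (l j)⁻¹) hl' i).trans (Real.log_le_log (pos _ hl' i) (ha i))
    simp only [Real.log_inv, mul_neg, Finset.sum_neg_distrib] at this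
    rw [← inv_div, Real.log_inv]
    linarith
  have step1 : ∀ i, (Real.log (min β (max α (γ i)) / γ i)) ^ 2 ≤
      (∑ j, C i j ^ 2 * Real.log (l j)) ^ 2 := by
    intro i
    have g := hγ i
    rcases le_total (γ i) α with h | h
    · rw [max_eq_left h, min_eq_right hαβ.le]
      have : 0 ≤ Real.log (α / γ i) := Real.log_nonneg ((one_le_div g).2 h)
      have := lo i
      gcongr
    · rw [max_eq_right h]
      rcases le_total (γ i) β with h' | h'
      · rw [min_eq_right h', div_self g.ne']
        simp [sq_nonneg]
      · rw [min_eq_left h']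
        have : Real.log (β / γ i) ≤ 0 :=
          Real.log_nonpos (div_nonneg (hα.trans hαβ).le g.le) ((div_le_one g).2 h')
        have := up i
        nlinarith
  have step2 : ∀ i, (∑ j, C i j ^ 2 * Real.log (l j)) ^ 2 ≤
      ∑ j, C i j ^ 2 * Real.log (l j) ^ 2 := by
    intro i
    have := (even_two.convexOn_pow (𝕜 := ℝ)).map_sum_le (t := Finset.univ)
      (w := fun j => C i j ^ 2) (p := fun j => Real.log (l j))
      (fun j _ => sq_nonneg _) (row i) (fun j _ => Set.mem_univ _)
    simpa using this
  calc _ ≤ ∑ i, ∑ j, C i j ^ 2 * Real.log (l j) ^ 2 :=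
        Finset.sum_le_sum fun i _ => (step1 i).trans (step2 i)
    _ = ∑ j, ∑ i, C i j ^ 2 * Real.log (l j) ^ 2 := Finset.sum_comm
    _ = _ := by
      refine Finset.sum_congr rfl fun j _ => ?_
      rw [← Finset.sum_mul, col, one_mul]

lemma spec_real {n : ℕ} (A : Matrix (Fin n) (Fin n) ℝ) (hA : A.IsHermitian) :
    ∃ W : Matrix (Fin n) (Fin n) ℝ, Wᵀ * W = 1 ∧ W * Wᵀ = 1 ∧
      A = W * diagonal hA.eigenvalues * Wᵀ ∧
      ∀ f, hA.cfc f = W * diagonal (f ∘ hA.eigenvalues) * Wᵀ := by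
  refine ⟨(hA.eigenvectorUnitary : Matrix (Fin n) (Fin n) ℝ), ?_, ?_, ?_, ?_⟩
  · have := Unitary.coe_star_mul_self hA.eigenvectorUnitary
    rwa [star_eq_conjTranspose, conjTranspose_eq_transpose_of_trivial] at this
  · refine mul_eq_one_comm.1 ?_
    have := Unitary.coe_star_mul_self hA.eigenvectorUnitary
    rwa [star_eq_conjTranspose, conjTranspose_eq_transpose_of_trivial] at this
  · have := hA.spectral_theorem
    rwa [Unitary.conjStarAlgAut_apply, star_eq_conjTranspose,
      conjTranspose_eq_transpose_of_trivial] at this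
  · intro f
    rw [IsHermitian.cfc, Unitary.conjStarAlgAut_apply, star_eq_conjTranspose,
      conjTranspose_eq_transpose_of_trivial]
    rfl

lemma msqrt_spec {n : ℕ} (p : Matrix (Fin n) (Fin n) ℝ) (hp : p.PosDef) :
    (msqrt p)ᵀ = msqrt p ∧ msqrt p * msqrt p = p := by
  obtain ⟨W, h1, h2, h3, h4⟩ := spec_real p hp.1
  have e : msqrt p = W * diagonal (Real.sqrt ∘ hp.1.eigenvalues) * Wᵀ := by
    rw [msqrt, mfun, dif_pos hp.1, h4]
  constructor
  · rw [e]; simp [Matrix.mul_assoc]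
  · rw [e]
    conv_rhs => rw [h3]
    calc _ = W * (diagonal (Real.sqrt ∘ hp.1.eigenvalues) * ((Wᵀ * W) *
          diagonal (Real.sqrt ∘ hp.1.eigenvalues))) * Wᵀ := by simp only [Matrix.mul_assoc]
      _ = _ := by
        rw [h1, Matrix.one_mul, diagonal_mul_diagonal]
        congr 3
        funext i
        exact Real.mul_self_sqrt (hp.eigenvalues_pos i).le

lemma sum_eigs {n : ℕ} (A : Matrix (Fin n) (Fin n) ℝ) (hA : A.IsHermitian) (d : Fin n → ℝ)
    (h : A.charpoly = (diagonal d).charpoly) (f : ℝ → ℝ) :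
    ∑ i, f (eigs A i) = ∑ i, f (d i) := by
  have r := hA.roots_charpoly_eq_eigenvalues
  rw [h, charpoly_diagonal, Polynomial.roots_prod _ _
    (by simp [Finset.prod_ne_zero_iff, Polynomial.X_sub_C_ne_zero])] at r
  have r' : Multiset.map d Finset.univ.val = Multiset.map hA.eigenvalues Finset.univ.val := by
    simpa using r
  have := congrArg (fun s => (s.map f).sum) r'
  simp only [Multiset.map_map] at this
  rw [eigs, dif_pos hA]
  exact this.symm

lemma diag_conj {n : ℕ} (C : Matrix (Fin n) (Fin n) ℝ) (d : Fin n → ℝ) (i : Fin n) :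
    (C * diagonal d * Cᵀ) i i = ∑ j, C i j ^ 2 * d j := by
  rw [Matrix.mul_apply]
  refine Finset.sum_congr rfl fun j _ => ?_
  rw [Matrix.mul_diagonal, transpose_apply]
  ring

lemma psd_conj {n : ℕ} (U : Matrix (Fin n) (Fin n) ℝ) (A : Matrix (Fin n) (Fin n) ℝ)
    (hA : A.PosSemidef) : (U * A * Uᵀ).PosSemidef := by
  have := hA.mul_mul_conjTranspose_same U
  rwa [conjTranspose_eq_transpose_of_trivial] at this

/-- Projection onto the order interval `[αI, βI]` is given by clamping the
eigenvalues of `p` to `[α,β]`. -/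
theorem projection_onto_order_interval {n : ℕ} (α β : ℝ) (hα : 0 < α) (hαβ : α < β)
    (U : Matrix (Fin n) (Fin n) ℝ) (hU : Uᵀ * U = 1)
    (γ : Fin n → ℝ) (hγpos : ∀ i, 0 < γ i) (hγmono : Antitone γ)
    (p : Matrix (Fin n) (Fin n) ℝ) (hp : p.PosDef)
    (hpU : p = Uᵀ * Matrix.diagonal γ * U) :
    Loewner (α • (1 : Matrix (Fin n) (Fin n) ℝ))
        (Uᵀ * Matrix.diagonal (fun i => min β (max α (γ i))) * U)
    ∧ Loewner (Uᵀ * Matrix.diagonal (fun i => min β (max α (γ i))) * U)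
        (β • (1 : Matrix (Fin n) (Fin n) ℝ))
    ∧ ∀ q : Matrix (Fin n) (Fin n) ℝ, q.PosDef →
        Loewner (α • (1 : Matrix (Fin n) (Fin n) ℝ)) q →
        Loewner q (β • (1 : Matrix (Fin n) (Fin n) ℝ)) →
        dR p (Uᵀ * Matrix.diagonal (fun i => min β (max α (γ i))) * U) ≤ dR p q := by
  have hU' : U * Uᵀ = 1 := mul_eq_one_comm.1 hU
  obtain ⟨hSt, hSS⟩ := msqrt_spec p hp
  have hpdet : IsUnit p.det := (isUnit_iff_isUnit_det _).1 hp.isUnit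
  have hSdet : IsUnit (msqrt p).det := by
    rw [← hSS, det_mul] at hpdet
    exact isUnit_of_mul_isUnit_left hpdet
  have hζ : ∀ i, α ≤ min β (max α (γ i)) := fun i => le_min hαβ.le (le_max_left _ _)
  have hζ' : ∀ i, min β (max α (γ i)) ≤ β := fun i => min_le_left _ _
  generalize hz : (fun i => min β (max α (γ i))) = ζ
  have hz' : ∀ i, ζ i = min β (max α (γ i)) := fun i => by rw [← hz]
  have hsm : ∀ c : ℝ, c • (1 : Matrix (Fin n) (Fin n) ℝ) = Uᵀ * diagonal (fun _ => c) * U := by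
    intro c
    rw [← smul_one_eq_diagonal, Matrix.mul_smul, Matrix.smul_mul, Matrix.mul_one, hU]
  refine ⟨?_, ?_, ?_⟩
  · rw [Loewner, hsm, ← Matrix.sub_mul, ← Matrix.mul_sub, diagonal_sub]
    have := psd_conj Uᵀ _ (PosSemidef.diagonal (d := fun i => ζ i - α)
      (fun i => by simpa [hz'] using hζ i))
    rwa [transpose_transpose] at this
  · rw [Loewner, hsm, ← Matrix.sub_mul, ← Matrix.mul_sub, diagonal_sub]
    have := psd_conj Uᵀ _ (PosSemidef.diagonal (d := fun i => β - ζ i)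
      (fun i => by simp [hz']))
    rwa [transpose_transpose] at this
  intro q hq hq1 hq2
  have hqdet : IsUnit q.det := (isUnit_iff_isUnit_det _).1 hq.isUnit
  have hqq : q * q⁻¹ = 1 := mul_nonsing_inv _ hqdet
  have hqq' : q⁻¹ * q = 1 := nonsing_inv_mul _ hqdet
  have hqt : (q⁻¹)ᵀ = q⁻¹ := by
    have := hq.1.inv
    rwa [IsHermitian, conjTranspose_eq_transpose_of_trivial] at this
  rw [dR, dR]
  apply Real.sqrt_le_sqrt
  generalize msqrt p = S at hSt hSS hSdet
  have hST : S * S⁻¹ = 1 := mul_nonsing_inv _ hSdet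
  have hTS : S⁻¹ * S = 1 := nonsing_inv_mul _ hSdet
  have hTt : (S⁻¹)ᵀ = S⁻¹ := by rw [transpose_nonsing_inv, hSt]
  generalize S⁻¹ = T at hST hTS hTt
  have hTT : T * T = Uᵀ * diagonal (fun i => (γ i)⁻¹) * U := by
    have h1 : (T * T) * p = 1 := by
      rw [← hSS, Matrix.mul_assoc, ← Matrix.mul_assoc T S S, hTS, Matrix.one_mul, hTS]
    have h2 : p * (Uᵀ * diagonal (fun i => (γ i)⁻¹) * U) = 1 := by
      rw [hpU]
      calc _ = Uᵀ * (diagonal γ * ((U * Uᵀ) * diagonal (fun i => (γ i)⁻¹))) * U := by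
            simp only [Matrix.mul_assoc]
        _ = 1 := by
          rw [hU', Matrix.one_mul, diagonal_mul_diagonal]
          simp [mul_inv_cancel₀ (hγpos _).ne', hU]
    exact left_inv_eq_right_inv h1 h2
  have hQh : (T * (Uᵀ * diagonal ζ * U) * T).IsHermitian := by
    rw [IsHermitian, conjTranspose_eq_transpose_of_trivial]
    simp [Matrix.mul_assoc, hTt]
  have hch : (T * (Uᵀ * diagonal ζ * U) * T).charpoly
      = (diagonal (fun i => min β (max α (γ i)) / γ i)).charpoly := by
    rw [Matrix.mul_assoc T, charpoly_mul_comm, Matrix.mul_assoc _ T T, hTT]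
    have : Uᵀ * diagonal ζ * U * (Uᵀ * diagonal (fun i => (γ i)⁻¹) * U)
        = Uᵀ * (diagonal ζ * ((U * Uᵀ) * diagonal (fun i => (γ i)⁻¹)) * U) := by
      simp only [Matrix.mul_assoc]
    rw [this, charpoly_mul_comm, Matrix.mul_assoc, hU', Matrix.mul_one, Matrix.one_mul,
      diagonal_mul_diagonal]
    simp only [hz', div_eq_mul_inv]
  rw [sum_eigs _ hQh _ hch (fun x => Real.log x ^ 2)]
  have hX : (T * q * T).PosDef := by
    have := hq.mul_mul_conjTranspose_same (B := T)
      (vecMul_injective_of_isUnit (IsUnit.of_mul_eq_one _ hTS))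
    rwa [conjTranspose_eq_transpose_of_trivial, hTt] at this
  obtain ⟨W, hW1, hW2, hW3, -⟩ := spec_real _ hX.1
  have he : eigs (T * q * T) = hX.1.eigenvalues := by rw [eigs, dif_pos hX.1]
  rw [he]
  have hlpos := hX.eigenvalues_pos
  generalize hX.1.eigenvalues = l at hW3 hlpos
  have hXinv : S * q⁻¹ * S = W * diagonal (fun i => (l i)⁻¹) * Wᵀ := by
    have h1 : (S * q⁻¹ * S) * (T * q * T) = 1 := by
      calc _ = S * (q⁻¹ * ((S * T) * q)) * T := by simp only [Matrix.mul_assoc]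
        _ = 1 := by rw [hST, Matrix.one_mul, hqq', Matrix.mul_one, hST]
    have h2 : (T * q * T) * (W * diagonal (fun i => (l i)⁻¹) * Wᵀ) = 1 := by
      rw [hW3]
      calc _ = W * (diagonal l * ((Wᵀ * W) * diagonal (fun i => (l i)⁻¹))) * Wᵀ := by
            simp only [Matrix.mul_assoc]
        _ = 1 := by
          rw [hW1, Matrix.one_mul, diagonal_mul_diagonal]
          simp [mul_inv_cancel₀ (hlpos _).ne', hW2]
    exact left_inv_eq_right_inv h1 h2
  have conjU : ∀ d : Fin n → ℝ, U * (Uᵀ * diagonal d * U) * Uᵀ = diagonal d := by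
    intro d
    calc _ = (U * Uᵀ) * diagonal d * (U * Uᵀ) := by simp only [Matrix.mul_assoc]
      _ = _ := by rw [hU', Matrix.one_mul, Matrix.mul_one]
  have conjW : ∀ d : Fin n → ℝ, U * (W * diagonal d * Wᵀ) * Uᵀ
      = (U * W) * diagonal d * (U * W)ᵀ := by
    intro d
    simp only [Matrix.mul_assoc, transpose_mul]
  have hbeta := psd_conj U _ (psd_conj T _ hq2)
  have hqinv : (α⁻¹ • (1 : Matrix (Fin n) (Fin n) ℝ) - q⁻¹).PosSemidef := by
    have a1 := psd_conj q⁻¹ _ hq1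
    have a2 := (psd_conj (1 - α • q⁻¹) 1 PosSemidef.one).smul (inv_pos.2 hα).le
    have := a1.add a2
    convert this using 1
    simp only [hqt, transpose_sub, transpose_smul, transpose_one, Matrix.mul_one, Matrix.mul_sub,
      Matrix.sub_mul, Matrix.one_mul, hqq', Matrix.mul_smul, Matrix.smul_mul, smul_sub, smul_smul,
      inv_mul_cancel₀ hα.ne', one_smul, mul_one, inv_mul_cancel_left₀ hα.ne']
    abel
  have halpha := psd_conj U _ (psd_conj S _ hqinv)
  refine core_scalar α β hα hαβ (U * W) ?_ ?_ l γ hlpos hγpos ?_ ?_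
  · calc _ = U * (W * Wᵀ) * Uᵀ := by simp only [Matrix.mul_assoc, transpose_mul]
      _ = 1 := by rw [hW2, Matrix.mul_one, hU']
  · calc _ = Wᵀ * (Uᵀ * U) * W := by simp only [Matrix.mul_assoc, transpose_mul]
      _ = 1 := by rw [hU, Matrix.mul_one, hW1]
  · intro i
    have h := hbeta.diag_nonneg (i := i)
    rw [hTt, Matrix.mul_sub, Matrix.sub_mul, hW3, Matrix.mul_sub, Matrix.sub_mul, conjW,
      Matrix.mul_smul, Matrix.mul_one, Matrix.smul_mul, hTT, Matrix.mul_smul, Matrix.smul_mul,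
      conjU, Matrix.sub_apply, diag_conj, Matrix.smul_apply, diagonal_apply_eq] at h
    rw [div_eq_mul_inv]
    simpa using h
  · intro i
    have h := halpha.diag_nonneg (i := i)
    rw [hSt, Matrix.mul_sub, Matrix.sub_mul, hXinv, Matrix.mul_sub, Matrix.sub_mul, conjW,
      Matrix.mul_smul, Matrix.mul_one, Matrix.smul_mul, hSS, hpU, Matrix.mul_smul, Matrix.smul_mul,
      conjU, Matrix.sub_apply, diag_conj, Matrix.smul_apply, diagonal_apply_eq] at h
    rw [div_eq_inv_mul]
    simpa using h
end

section
/- Let A be an invertible real n×n matrix, let k ∈ {1,…,n−1} and s ∈ [0,1), and define J : S⁺_n → ℝ by J(p) = ∑_{i=1}^k log₂ α_i(p^{1/2} A p^{-1/2}) + s·log₂ α_{k+1}(p^{1/2} A p^{-1/2}). Then J is globally Lipschitz with constant √n/ln 2 with respect to the Riemannian distance d: |J(p) − J(q)| ≤ (√n/ln 2)·d(p,q) for all p, q ∈ S⁺_n. -/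
open Matrix Real Filter

open SPD


namespace JLip

theorem det_sum_fun {n k : ℕ} (W : Matrix (Fin n) (Fin k) ℝ) (l : Fin n → ℝ) :
    (Wᵀ * diagonal l * W).det =
      ∑ f : Fin k → Fin n, (∏ i, l (f i)) * (∏ i, W (f i) i) * (W.submatrix f id).det := by
  have key : ∀ σ : Equiv.Perm (Fin k), (∏ i, (Wᵀ * diagonal l * W) (σ i) i)
      = ∑ f : Fin k → Fin n, ∏ i, (W (f i) (σ i) * l (f i) * W (f i) i) := by
    intro σ
    have h := Finset.prod_univ_sum (fun _ : Fin k => (Finset.univ : Finset (Fin n)))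
      (fun i j => W j (σ i) * l j * W j i)
    rw [Fintype.piFinset_univ] at h
    rw [← h]
    refine Finset.prod_congr rfl fun i _ => ?_
    rw [Matrix.mul_apply]
    refine Finset.sum_congr rfl fun j _ => ?_
    rw [Matrix.mul_diagonal, Matrix.transpose_apply]
  rw [Matrix.det_apply']
  simp_rw [key, Finset.mul_sum]
  rw [Finset.sum_comm]
  refine Finset.sum_congr rfl fun f _ => ?_
  rw [← Matrix.det_transpose (W.submatrix f id), Matrix.det_apply', Finset.mul_sum]
  refine Finset.sum_congr rfl fun σ _ => ?_
  simp only [Finset.prod_mul_distrib, Matrix.transpose_apply, Matrix.submatrix_apply, id]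
  ring

theorem det_sum_sq {n k : ℕ} (W : Matrix (Fin n) (Fin k) ℝ) (l : Fin n → ℝ) :
    (k.factorial : ℝ) * (Wᵀ * diagonal l * W).det =
      ∑ f : Fin k → Fin n, (∏ i, l (f i)) * (W.submatrix f id).det ^ 2 := by
  have h1 : ∀ τ : Equiv.Perm (Fin k), (Wᵀ * diagonal l * W).det =
      ∑ f : Fin k → Fin n, (∏ i, l (f i)) * (W.submatrix f id).det *
        (((Equiv.Perm.sign τ : ℤ) : ℝ) * ∏ i, (W.submatrix f id) (τ i) i) := by
    intro τ
    rw [det_sum_fun, ← (Equiv.arrowCongr τ.symm (Equiv.refl (Fin n))).sum_comp]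
    refine Finset.sum_congr rfl fun f _ => ?_
    have e1 : (Equiv.arrowCongr τ.symm (Equiv.refl (Fin n))) f = f ∘ τ := by
      ext i; simp
    rw [e1]
    have e2 : (W.submatrix (f ∘ τ) id) = (W.submatrix f id).submatrix τ id := by
      ext; simp
    rw [e2, Matrix.det_permute]
    have e3 : ∏ i, l ((f ∘ τ) i) = ∏ i, l (f i) := by
      simpa using Equiv.prod_comp τ (fun i => l (f i))
    rw [e3]
    simp only [Matrix.submatrix_apply, id, Function.comp]
    ring
  have h2 : (k.factorial : ℝ) * (Wᵀ * diagonal l * W).det =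
      ∑ _τ : Equiv.Perm (Fin k), (Wᵀ * diagonal l * W).det := by
    simp [Fintype.card_perm]
  rw [h2, Finset.sum_congr rfl (fun τ _ => h1 τ), Finset.sum_comm]
  refine Finset.sum_congr rfl fun f _ => ?_
  rw [← Finset.mul_sum, ← Matrix.det_apply']
  ring

theorem det_le {n k : ℕ} (W : Matrix (Fin n) (Fin k) ℝ) (l m : Fin n → ℝ) (C : ℝ)
    (h : ∀ f : Fin k → Fin n, Function.Injective f → ∏ i, l (f i) ≤ C * ∏ i, m (f i)) :
    (Wᵀ * diagonal l * W).det ≤ C * (Wᵀ * diagonal m * W).det := by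
  have hk : (0:ℝ) < k.factorial := by exact_mod_cast k.factorial_pos
  refine le_of_mul_le_mul_left ?_ hk
  rw [mul_left_comm, det_sum_sq, det_sum_sq, Finset.mul_sum]
  refine Finset.sum_le_sum fun f _ => ?_
  by_cases hf : Function.Injective f
  · rw [← mul_assoc]
    exact mul_le_mul_of_nonneg_right (h f hf) (sq_nonneg _)
  · have : (W.submatrix f id).det = 0 := by
      simp only [Function.Injective, not_forall] at hf
      obtain ⟨a, b, hab, hne⟩ := hf
      exact Matrix.det_zero_of_row_eq hne (by ext; simp [hab])
    simp [this]

/-- spectral theorem in real form -/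
theorem spectral {n : ℕ} (P : Matrix (Fin n) (Fin n) ℝ) (hP : P.IsHermitian) :
    ∃ U : Matrix (Fin n) (Fin n) ℝ, Uᵀ * U = 1 ∧ U * Uᵀ = 1 ∧ P = U * diagonal (eigs P) * Uᵀ ∧
      ∀ f, mfun P f = U * diagonal (fun i => f (eigs P i)) * Uᵀ := by
  have hU := hP.eigenvectorUnitary.2
  have e : eigs P = hP.eigenvalues := dif_pos hP
  refine ⟨hP.eigenvectorUnitary, ?_, ?_, ?_, ?_⟩
  · simpa [Matrix.star_eq_conjTranspose, Matrix.conjTranspose_eq_transpose_of_trivial]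
      using Unitary.star_mul_self_of_mem hU
  · simpa [Matrix.star_eq_conjTranspose, Matrix.conjTranspose_eq_transpose_of_trivial]
      using Unitary.mul_star_self_of_mem hU
  · rw [e]
    have := hP.spectral_theorem
    rw [Unitary.conjStarAlgAut_apply] at this
    simpa [Matrix.star_eq_conjTranspose, Matrix.conjTranspose_eq_transpose_of_trivial,
      Function.comp_def] using this
  · intro f
    rw [e]
    have e' : mfun P f = hP.cfc f := dif_pos hP
    rw [e']
    simp [Matrix.IsHermitian.cfc, Unitary.conjStarAlgAut_apply,
      Matrix.star_eq_conjTranspose, Matrix.conjTranspose_eq_transpose_of_trivial,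
      Function.comp_def]

theorem det_spec_le {n k : ℕ} (P : Matrix (Fin n) (Fin n) ℝ) (hP : P.IsHermitian)
    (W : Matrix (Fin n) (Fin k) ℝ) (C : ℝ)
    (h : ∀ f : Fin k → Fin n, Function.Injective f → ∏ i, eigs P (f i) ≤ C) :
    (Wᵀ * P * W).det ≤ C * (Wᵀ * W).det := by
  obtain ⟨U, h1, h2, h3, -⟩ := spectral P hP
  have := det_le (Uᵀ * W) (eigs P) (fun _ => 1) C (by simpa using h)
  have e1 : (Uᵀ * W)ᵀ * diagonal (eigs P) * (Uᵀ * W) = Wᵀ * P * W := by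
    conv_rhs => rw [h3]
    simp [Matrix.mul_assoc]
  have e2 : (Uᵀ * W)ᵀ * (diagonal (fun _ => 1) : Matrix (Fin n) (Fin n) ℝ) * (Uᵀ * W) = Wᵀ * W := by
    rw [Matrix.diagonal_one, Matrix.mul_one, Matrix.transpose_mul, Matrix.transpose_transpose,
      Matrix.mul_assoc, ← Matrix.mul_assoc U, h2, Matrix.one_mul]
  rwa [e1, e2] at this

theorem det_spec_ge {n k : ℕ} (P : Matrix (Fin n) (Fin n) ℝ) (hP : P.IsHermitian)
    (W : Matrix (Fin n) (Fin k) ℝ) (C : ℝ)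
    (h : ∀ f : Fin k → Fin n, Function.Injective f → 1 ≤ C * ∏ i, eigs P (f i)) :
    (Wᵀ * W).det ≤ C * (Wᵀ * P * W).det := by
  obtain ⟨U, h1, h2, h3, -⟩ := spectral P hP
  have := det_le (Uᵀ * W) (fun _ => 1) (eigs P) C (by simpa using h)
  have e1 : (Uᵀ * W)ᵀ * diagonal (eigs P) * (Uᵀ * W) = Wᵀ * P * W := by
    conv_rhs => rw [h3]
    simp [Matrix.mul_assoc]
  have e2 : (Uᵀ * W)ᵀ * (diagonal (fun _ => 1) : Matrix (Fin n) (Fin n) ℝ) * (Uᵀ * W) = Wᵀ * W := by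
    rw [Matrix.diagonal_one, Matrix.mul_one, Matrix.transpose_mul, Matrix.transpose_transpose,
      Matrix.mul_assoc, ← Matrix.mul_assoc U, h2, Matrix.one_mul]
  rwa [e1, e2] at this

theorem prod_le_top {n k : ℕ} (hk : k ≤ n) (a : Fin n → ℝ) (ha : Antitone a) (h0 : ∀ i, 0 ≤ a i)
    (f : Fin k → Fin n) (hf : Function.Injective f) :
    ∏ i, a (f i) ≤ ∏ i : Fin k, a (Fin.castLE hk i) := by
  classical
  have hc : (Finset.univ.image f).card = k := by
    rw [Finset.card_image_of_injective _ hf]; simp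
  set g := (Finset.univ.image f).orderEmbOfFin hc
  have e : ∏ i, a (f i) = ∏ i, a (g i) := by
    rw [← Finset.prod_image (s := Finset.univ) (g := f) (f := a) (fun x _ y _ h => hf h)]
    conv_lhs => rw [← Finset.image_orderEmbOfFin_univ _ hc]
    rw [Finset.prod_image (fun x _ y _ h => g.injective h)]
  rw [e]
  refine Finset.prod_le_prod (fun i _ => h0 _) fun i _ => ha ?_
  have hg : StrictMono g := g.strictMono
  have : ∀ m : ℕ, ∀ hm : m < k, m ≤ (g ⟨m, hm⟩ : ℕ) := by
    intro m
    induction m with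
    | zero => intro _; exact Nat.zero_le _
    | succ m ih =>
      intro hm
      have h1 := ih (by omega)
      have h2 : g ⟨m, by omega⟩ < g ⟨m+1, hm⟩ := hg (by simp)
      have h3 : (g ⟨m, by omega⟩ : ℕ) < g ⟨m+1, hm⟩ := h2
      omega
  exact this i i.2

/-- sorted squared singular values -/
noncomputable def sq {n : ℕ} (M : Matrix (Fin n) (Fin n) ℝ) (i : Fin n) : ℝ :=
  eigs (Mᵀ * M) (Tuple.sort (eigs (Mᵀ * M)) i.rev)

theorem herm {n : ℕ} (M : Matrix (Fin n) (Fin n) ℝ) : (Mᵀ * M).IsHermitian := by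
  simpa [Matrix.conjTranspose_eq_transpose_of_trivial] using Matrix.isHermitian_conjTranspose_mul_self M

theorem posdef {n : ℕ} (M : Matrix (Fin n) (Fin n) ℝ) (hM : IsUnit M) : (Mᵀ * M).PosDef := by
  have := Matrix.PosDef.conjTranspose_mul_self M (Matrix.mulVec_injective_of_isUnit hM)
  simpa [Matrix.conjTranspose_eq_transpose_of_trivial] using this

theorem eigs_pos {n : ℕ} (P : Matrix (Fin n) (Fin n) ℝ) (hP : P.PosDef) (i : Fin n) :
    0 < eigs P i := by
  have := hP.eigenvalues_pos i
  have e : eigs P = hP.1.eigenvalues := dif_pos hP.1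
  rwa [e]

theorem sq_pos {n : ℕ} (M : Matrix (Fin n) (Fin n) ℝ) (hM : IsUnit M) (i : Fin n) : 0 < sq M i :=
  eigs_pos _ (posdef M hM) _

theorem sq_anti {n : ℕ} (M : Matrix (Fin n) (Fin n) ℝ) : Antitone (sq M) := by
  intro i j hij
  exact Tuple.monotone_sort (eigs (Mᵀ * M)) (Fin.rev_le_rev.mpr hij)

noncomputable def Om {n k : ℕ} (hk : k ≤ n) (M : Matrix (Fin n) (Fin n) ℝ) : ℝ :=
  ∏ i : Fin k, sq M (Fin.castLE hk i)

theorem Om_pos {n k : ℕ} (hk : k ≤ n) (M : Matrix (Fin n) (Fin n) ℝ) (hM : IsUnit M) :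
    0 < Om hk M := Finset.prod_pos fun i _ => sq_pos M hM _

theorem gram_le {n k : ℕ} (hk : k ≤ n) (M : Matrix (Fin n) (Fin n) ℝ) (hM : IsUnit M)
    (W : Matrix (Fin n) (Fin k) ℝ) :
    ((M * W)ᵀ * (M * W)).det ≤ Om hk M * (Wᵀ * W).det := by
  have e : (M * W)ᵀ * (M * W) = Wᵀ * (Mᵀ * M) * W := by simp [Matrix.mul_assoc]
  rw [e]
  refine det_spec_le _ (herm M) _ _ fun f hf => ?_
  set σ := Tuple.sort (eigs (Mᵀ * M)) with hσ
  have h := prod_le_top hk (sq M) (sq_anti M) (fun i => (sq_pos M hM i).le)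
    (fun i => (σ.symm (f i)).rev) (fun x y hxy => hf (by simpa using hxy))
  simpa [Om, sq, ← hσ] using h

theorem gram_attain {n k : ℕ} (hk : k ≤ n) (M : Matrix (Fin n) (Fin n) ℝ) :
    ∃ V : Matrix (Fin n) (Fin k) ℝ, Vᵀ * V = 1 ∧ ((M * V)ᵀ * (M * V)).det = Om hk M := by
  obtain ⟨U, h1, h2, h3, -⟩ := spectral _ (herm M)
  set σ := Tuple.sort (eigs (Mᵀ * M)) with hσ
  let g : Fin k → Fin n := fun i => σ (Fin.castLE hk i).rev
  have hg : Function.Injective g := by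
    intro x y hxy
    simpa [g] using hxy
  refine ⟨U.submatrix id g, ?_, ?_⟩
  · have : (U.submatrix id g)ᵀ * U.submatrix id g = (Uᵀ * U).submatrix g g := by
      ext; simp [Matrix.mul_apply]
    rw [this, h1, Matrix.submatrix_one _ hg]
  · have e : (M * U.submatrix id g)ᵀ * (M * U.submatrix id g) =
        (Uᵀ * (Mᵀ * M) * U).submatrix g g := by
      have : M * U.submatrix id g = (M * U).submatrix id g := by
        ext; simp [Matrix.mul_apply]
      rw [this]
      have e2 : Uᵀ * (Mᵀ * M) * U = (M * U)ᵀ * (M * U) := by simp [Matrix.mul_assoc]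
      rw [e2]
      ext; simp [Matrix.mul_apply]
    have e3 : Uᵀ * (Mᵀ * M) * U = diagonal (eigs (Mᵀ * M)) := by
      conv_lhs => rw [h3]
      calc Uᵀ * (U * diagonal (eigs (Mᵀ * M)) * Uᵀ) * U
          = (Uᵀ * U) * diagonal (eigs (Mᵀ * M)) * (Uᵀ * U) := by simp only [Matrix.mul_assoc]
        _ = _ := by rw [h1]; simp
    rw [e, e3, Matrix.submatrix_diagonal _ _ hg, Matrix.det_diagonal]
    rfl

/-- abstract comparison -/
theorem Om_conj_le {n k : ℕ} (hk : k ≤ n) (M B B' : Matrix (Fin n) (Fin n) ℝ) (hM : IsUnit M)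
    (c c' : ℝ) (hc : 0 ≤ c)
    (h1 : ∀ W : Matrix (Fin n) (Fin k) ℝ, ((B * W)ᵀ * (B * W)).det ≤ c * (Wᵀ * W).det)
    (h2 : ∀ W : Matrix (Fin n) (Fin k) ℝ, ((B' * W)ᵀ * (B' * W)).det ≤ c' * (Wᵀ * W).det) :
    Om hk (B * M * B') ≤ c * c' * Om hk M := by
  obtain ⟨V, hV, hV2⟩ := gram_attain hk (B * M * B')
  rw [← hV2]
  have e : B * M * B' * V = B * (M * (B' * V)) := by simp only [Matrix.mul_assoc]
  rw [e]
  have a1 := h1 (M * (B' * V))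
  have a2 := gram_le hk M hM (B' * V)
  have a3 := h2 V
  rw [hV, Matrix.det_one, mul_one] at a3
  have p := (Om_pos hk M hM).le
  calc _ ≤ _ := a1
    _ ≤ c * (Om hk M * c') := by gcongr; exact a2.trans (by gcongr)
    _ = _ := by ring

theorem prod_inj_le {n k : ℕ} (m : Fin n → ℝ) (h0 : ∀ i, 1 ≤ m i) (f : Fin k → Fin n)
    (hf : Function.Injective f) : ∏ i, m (f i) ≤ ∏ j, m j := by
  classical
  rw [← Finset.prod_image (s := Finset.univ) (g := f) (f := m) (fun x _ y _ h => hf h)]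
  rw [← Finset.prod_sdiff (Finset.subset_univ (Finset.univ.image f))]
  refine le_mul_of_one_le_left (Finset.prod_nonneg fun i _ => zero_le_one.trans (h0 i)) ?_
  exact Finset.one_le_prod fun i _ => h0 i

/-- main comparison -/
theorem Om_log_le {n k : ℕ} (hk : k ≤ n) (M M' B B' : Matrix (Fin n) (Fin n) ℝ) (hM : IsUnit M)
    (hB : B' * B = 1) (hM' : M' = B * M * B') :
    |Real.log (Om hk M') - Real.log (Om hk M)| ≤ ∑ i, |Real.log (eigs (Bᵀ * B) i)| := by
  have hB' : B * B' = 1 := mul_eq_one_comm.mp hB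
  have uB : IsUnit B := IsUnit.of_mul_eq_one _ hB'
  have uB' : IsUnit B' := IsUnit.of_mul_eq_one _ hB
  have uM' : IsUnit M' := by rw [hM']; exact (uB.mul hM).mul uB'
  set μ := eigs (Bᵀ * B) with hμ
  have μpos : ∀ i, 0 < μ i := eigs_pos _ (posdef B uB)
  set c := ∏ i, max 1 (μ i) with hc
  set c' := ∏ i, max 1 (μ i)⁻¹ with hc'
  have cpos : 0 < c := Finset.prod_pos fun i _ => lt_max_of_lt_left one_pos
  have cpos' : 0 < c' := Finset.prod_pos fun i _ => lt_max_of_lt_left one_pos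
  have h1 : ∀ W : Matrix (Fin n) (Fin k) ℝ, ((B * W)ᵀ * (B * W)).det ≤ c * (Wᵀ * W).det := by
    intro W
    have e : (B * W)ᵀ * (B * W) = Wᵀ * (Bᵀ * B) * W := by simp [Matrix.mul_assoc]
    rw [e]
    refine det_spec_le _ (herm B) _ _ fun f hf => ?_
    refine le_trans ?_ (prod_inj_le (fun i => max 1 (μ i)) (fun i => le_max_left _ _) f hf)
    exact Finset.prod_le_prod (fun i _ => (μpos _).le) fun i _ => le_max_right _ _
  have h2 : ∀ W : Matrix (Fin n) (Fin k) ℝ, ((B' * W)ᵀ * (B' * W)).det ≤ c' * (Wᵀ * W).det := by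
    intro W
    have e : Wᵀ * W = (B' * W)ᵀ * (Bᵀ * B) * (B' * W) := by
      have : (B' * W)ᵀ * (Bᵀ * B) * (B' * W) = (B * B' * W)ᵀ * (B * B' * W) := by
        simp [Matrix.mul_assoc]
      rw [this, hB', Matrix.one_mul]
    rw [e]
    refine det_spec_ge _ (herm B) _ _ fun f hf => ?_
    have := prod_inj_le (fun i => max 1 (μ i)⁻¹) (fun i => le_max_left _ _) f hf
    have h3 : (∏ i, μ (f i))⁻¹ ≤ c' := by
      refine le_trans ?_ this
      rw [← Finset.prod_inv_distrib]
      exact Finset.prod_le_prod (fun i _ => (inv_pos.mpr (μpos _)).le) fun i _ => le_max_right _ _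
    have h4 : 0 < ∏ i, μ (f i) := Finset.prod_pos fun i _ => μpos _
    exact (inv_le_iff_one_le_mul₀ h4).mp h3
  have i1 : Om hk M' ≤ c * c' * Om hk M := by
    rw [hM']; exact Om_conj_le hk M B B' hM c c' cpos.le h1 h2
  have i2 : Om hk M ≤ c' * c * Om hk M' := by
    have e : M = B' * M' * B := by
      rw [hM']
      calc M = (B' * B) * M * (B' * B) := by rw [hB]; simp
        _ = _ := by simp only [Matrix.mul_assoc]
    conv_lhs => rw [e]
    exact Om_conj_le hk M' B' B uM' c' c cpos'.le h2 h1
  have p1 := Om_pos hk M hM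
  have p2 := Om_pos hk M' uM'
  have lc : Real.log (c * c') = ∑ i, |Real.log (μ i)| := by
    rw [hc, hc', ← Finset.prod_mul_distrib, Real.log_prod]
    · refine Finset.sum_congr rfl fun i _ => ?_
      rcases le_total 1 (μ i) with h | h
      · rw [max_eq_right h, max_eq_left (inv_le_one_of_one_le₀ h), mul_one,
          abs_of_nonneg (Real.log_nonneg h)]
      · rw [max_eq_left h, max_eq_right ((one_le_inv₀ (μpos i)).mpr h), one_mul, Real.log_inv,
          abs_of_nonpos (Real.log_nonpos (μpos i).le h)]
    · intro i _
      exact (mul_pos (lt_max_of_lt_left one_pos) (lt_max_of_lt_left one_pos)).ne'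
  have j1 := Real.log_le_log p2 i1
  have j2 := Real.log_le_log p1 i2
  rw [mul_comm c' c] at j2
  rw [Real.log_mul (mul_pos cpos cpos').ne' p1.ne', lc] at j1
  rw [Real.log_mul (mul_pos cpos cpos').ne' p2.ne', lc] at j2
  rw [abs_le]
  constructor <;> linarith

theorem msqrt_facts {n : ℕ} (p : Matrix (Fin n) (Fin n) ℝ) (hp : p.PosDef) :
    (msqrt p)ᵀ = msqrt p ∧ msqrt p * msqrt p = p ∧ IsUnit (msqrt p) := by
  obtain ⟨U, h1, h2, h3, h4⟩ := spectral p hp.1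
  have hs : msqrt p = U * diagonal (fun i => Real.sqrt (eigs p i)) * Uᵀ := h4 _
  have hmul : msqrt p * msqrt p = p := by
    rw [hs]
    conv_rhs => rw [h3]
    calc _ = U * diagonal (fun i => Real.sqrt (eigs p i)) * (Uᵀ * U) *
          diagonal (fun i => Real.sqrt (eigs p i)) * Uᵀ := by simp only [Matrix.mul_assoc]
      _ = U * (diagonal (fun i => Real.sqrt (eigs p i)) *
          diagonal (fun i => Real.sqrt (eigs p i))) * Uᵀ := by
            rw [h1]; simp only [Matrix.mul_assoc, Matrix.one_mul]
      _ = _ := by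
        rw [Matrix.diagonal_mul_diagonal]
        congr 3
        ext i
        rw [Real.mul_self_sqrt (eigs_pos p hp i).le]
  refine ⟨?_, hmul, ?_⟩
  · rw [hs]; simp [Matrix.mul_assoc]
  · have : IsUnit (msqrt p * msqrt p) := by rw [hmul]; exact hp.isUnit
    exact isUnit_of_mul_isUnit_left this

theorem sum_log {n k : ℕ} (hk : k ≤ n) (M : Matrix (Fin n) (Fin n) ℝ) (hM : IsUnit M) :
    ∑ i ∈ Finset.univ.filter (fun i : Fin n => (i : ℕ) < k), Real.logb 2 (svals M i)
      = Real.log (Om hk M) / (2 * Real.log 2) := by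
  have h1 : ∀ i, Real.logb 2 (svals M i) = Real.log (sq M i) / (2 * Real.log 2) := by
    intro i
    have : svals M i = Real.sqrt (sq M i) := rfl
    rw [this, Real.logb, Real.log_sqrt (sq_pos M hM i).le]
    field_simp
  have h2 : Finset.univ.filter (fun i : Fin n => (i : ℕ) < k)
      = Finset.univ.map (Fin.castLEEmb hk) := by
    ext i
    simp only [Finset.mem_filter, Finset.mem_univ, true_and, Finset.mem_map]
    constructor
    · intro h; exact ⟨⟨i, h⟩, by ext; simp⟩
    · rintro ⟨j, rfl⟩; simp
  rw [h2, Finset.sum_map, Om, Real.log_prod (fun i _ => (sq_pos M hM _).ne'), Finset.sum_div]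
  exact Finset.sum_congr rfl fun i _ => h1 _

theorem last_log {n k : ℕ} (hk : k + 1 ≤ n) (M : Matrix (Fin n) (Fin n) ℝ) (hM : IsUnit M) :
    Real.logb 2 (svals M ⟨k, hk⟩)
      = (Real.log (Om hk M) - Real.log (Om (Nat.le_of_succ_le hk) M)) / (2 * Real.log 2) := by
  have : svals M ⟨k, hk⟩ = Real.sqrt (sq M ⟨k, hk⟩) := rfl
  rw [this, Real.logb, Real.log_sqrt (sq_pos M hM _).le]
  have e : Om hk M = Om (Nat.le_of_succ_le hk) M * sq M ⟨k, hk⟩ := by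
    rw [Om, Fin.prod_univ_castSucc]; rfl
  rw [e, Real.log_mul (Om_pos _ M hM).ne' (sq_pos M hM _).ne']
  field_simp
  ring

end JLip

/-- `J(p) = ∑_{i=1}^k log₂ α_i(p^{1/2} A p^{-1/2}) + s·log₂ α_{k+1}(p^{1/2} A p^{-1/2})`
is globally Lipschitz with constant `√n / ln 2` with respect to the Riemannian distance. -/
theorem J_lipschitz {n : ℕ} (A : Matrix (Fin n) (Fin n) ℝ) (hA : IsUnit A.det)
    (k : ℕ) (hk1 : 1 ≤ k) (hkn : k ≤ n - 1) (s : ℝ) (hs : s ∈ Set.Ico (0:ℝ) 1) :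
    ∀ p q : Matrix (Fin n) (Fin n) ℝ, p.PosDef → q.PosDef →
      |((∑ i ∈ Finset.univ.filter (fun i : Fin n => (i : ℕ) < k),
            Real.logb 2 (svals (msqrt p * A * (msqrt p)⁻¹) i))
          + s * Real.logb 2 (svals (msqrt p * A * (msqrt p)⁻¹) ⟨k, by omega⟩))
        - ((∑ i ∈ Finset.univ.filter (fun i : Fin n => (i : ℕ) < k),
            Real.logb 2 (svals (msqrt q * A * (msqrt q)⁻¹) i))
          + s * Real.logb 2 (svals (msqrt q * A * (msqrt q)⁻¹) ⟨k, by omega⟩))|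
      ≤ (Real.sqrt n / Real.log 2) * dR p q := by
  intro p q hp hq
  obtain ⟨pt, pp, pu⟩ := JLip.msqrt_facts p hp
  obtain ⟨qt, qq, qu⟩ := JLip.msqrt_facts q hq
  have pd := (Matrix.isUnit_iff_isUnit_det _).mp pu
  have qd := (Matrix.isUnit_iff_isUnit_det _).mp qu
  have Au := (Matrix.isUnit_iff_isUnit_det _).mpr hA
  have piu : IsUnit (msqrt p)⁻¹ := Matrix.isUnit_nonsing_inv_iff.mpr pu
  have qiu : IsUnit (msqrt q)⁻¹ := Matrix.isUnit_nonsing_inv_iff.mpr qu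
  have hk' : k + 1 ≤ n := by omega
  have hk : k ≤ n := by omega
  set M := msqrt p * A * (msqrt p)⁻¹ with hM
  set M' := msqrt q * A * (msqrt q)⁻¹ with hM'
  have uM : IsUnit M := (pu.mul Au).mul piu
  have uM' : IsUnit M' := (qu.mul Au).mul qiu
  have a1 : (msqrt p)⁻¹ * msqrt p = 1 := Matrix.nonsing_inv_mul _ pd
  have a2 : (msqrt q)⁻¹ * msqrt q = 1 := Matrix.nonsing_inv_mul _ qd
  have a3 : msqrt p * (msqrt p)⁻¹ = 1 := Matrix.mul_nonsing_inv _ pd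
  have hBB : (msqrt p * (msqrt q)⁻¹) * (msqrt q * (msqrt p)⁻¹) = 1 := by
    calc _ = msqrt p * ((msqrt q)⁻¹ * msqrt q) * (msqrt p)⁻¹ := by simp only [Matrix.mul_assoc]
      _ = 1 := by rw [a2, Matrix.mul_one, a3]
  have hMM : M' = (msqrt q * (msqrt p)⁻¹) * M * (msqrt p * (msqrt q)⁻¹) := by
    rw [hM, hM']
    calc _ = msqrt q * ((msqrt p)⁻¹ * msqrt p) * A * ((msqrt p)⁻¹ * msqrt p) * (msqrt q)⁻¹ := by
          rw [a1]; simp only [Matrix.mul_one]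
      _ = _ := by simp only [Matrix.mul_assoc]
  have hG : (msqrt q * (msqrt p)⁻¹)ᵀ * (msqrt q * (msqrt p)⁻¹)
      = (msqrt p)⁻¹ * q * (msqrt p)⁻¹ := by
    rw [Matrix.transpose_mul, Matrix.transpose_nonsing_inv, pt, qt]
    conv_rhs => rw [← qq]
    simp only [Matrix.mul_assoc]
  have b1 := JLip.Om_log_le hk M M' _ _ uM hBB hMM
  have b2 := JLip.Om_log_le hk' M M' _ _ uM hBB hMM
  rw [hG] at b1 b2
  set μ := eigs ((msqrt p)⁻¹ * q * (msqrt p)⁻¹) with hμ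
  have cs : ∑ i, |Real.log (μ i)| ≤ Real.sqrt n * dR p q := by
    have h := Finset.sum_mul_sq_le_sq_mul_sq Finset.univ (fun _ : Fin n => (1:ℝ))
      (fun i => |Real.log (μ i)|)
    simp only [one_mul, one_pow, Finset.sum_const, Finset.card_univ, Fintype.card_fin,
      nsmul_eq_mul, mul_one, sq_abs] at h
    have h2 := Real.le_sqrt_of_sq_le h
    rwa [Real.sqrt_mul (Nat.cast_nonneg n)] at h2
  have l2 : 0 < Real.log 2 := Real.log_pos (by norm_num)
  rw [JLip.sum_log hk M uM, JLip.sum_log hk M' uM', JLip.last_log hk' M uM,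
    JLip.last_log hk' M' uM']
  obtain ⟨s0, s1⟩ := hs
  set S := ∑ i, |Real.log (μ i)| with hS
  have S0 : 0 ≤ S := Finset.sum_nonneg fun i _ => abs_nonneg _
  generalize Real.log (JLip.Om hk M) = x at *
  generalize Real.log (JLip.Om hk M') = x' at *
  generalize Real.log (JLip.Om hk' M) = y at *
  generalize Real.log (JLip.Om hk' M') = y' at *
  have e : x / (2 * Real.log 2) + s * ((y - x) / (2 * Real.log 2)) -
      (x' / (2 * Real.log 2) + s * ((y' - x') / (2 * Real.log 2)))
      = ((1 - s) * (x - x') + s * (y - y')) / 2 / Real.log 2 := by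
    field_simp
    ring
  rw [e, abs_div, abs_of_pos l2, div_mul_eq_mul_div]
  refine div_le_div_of_nonneg_right ?_ l2.le
  refine le_trans ?_ cs
  rw [abs_le] at b1 b2 ⊢
  obtain ⟨b11, b12⟩ := b1
  obtain ⟨b21, b22⟩ := b2
  have s1' : 0 ≤ 1 - s := by linarith
  constructor
  · nlinarith [mul_nonneg s1' (sub_nonneg.mpr b12), mul_nonneg s0 (sub_nonneg.mpr b22)]
  · nlinarith [mul_nonneg s1' (neg_le_iff_add_nonneg.mp b11), mul_nonneg s0 (neg_le_iff_add_nonneg.mp b21)]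
end

section
/- For all real symmetric n×n matrices X and Y, one has tr(X²Y²) − tr((XY)²) ≤ tr(X²)·tr(Y²). (Under the normalization tr(X²) = tr(Y²) = 1, tr(XY) = 0, this says that the sectional curvature K(X,Y) = −(1/2)·(tr(X²Y²) − tr((XY)²))/(tr(X²)tr(Y²) − tr(XY)²) of the space of positive definite matrices with the trace metric is bounded below by −1/2.) -/
open Matrix Real Filter

open SPD

theorem diag_bound_aux {n : ℕ} (d : Fin n → ℝ) (Z : Matrix (Fin n) (Fin n) ℝ)
    (hZ : ∀ i j, Z j i = Z i j) :
    (diagonal d * diagonal d * (Z * Z)).trace - (diagonal d * Z * (diagonal d * Z)).trace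
      ≤ (diagonal d * diagonal d).trace * (Z * Z).trace := by
  have h1 : (diagonal d * diagonal d * (Z * Z)).trace = ∑ i, ∑ j, d i ^ 2 * Z i j ^ 2 := by
    simp only [Matrix.trace, Matrix.diag_apply, diagonal_mul_diagonal, diagonal_mul]
    refine Finset.sum_congr rfl fun i _ => ?_
    rw [Matrix.mul_apply, Finset.mul_sum]
    refine Finset.sum_congr rfl fun j _ => ?_
    rw [hZ i j]; ring
  have h2 : (diagonal d * Z * (diagonal d * Z)).trace = ∑ i, ∑ j, d i * d j * Z i j ^ 2 := by
    simp only [Matrix.trace, Matrix.diag_apply]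
    refine Finset.sum_congr rfl fun i _ => ?_
    rw [Matrix.mul_apply]
    refine Finset.sum_congr rfl fun j _ => ?_
    rw [diagonal_mul, diagonal_mul, hZ i j]; ring
  have h3 : (diagonal d * diagonal d).trace = ∑ i, d i ^ 2 := by
    rw [diagonal_mul_diagonal, trace_diagonal]
    exact Finset.sum_congr rfl fun i _ => by ring
  have h4 : (Z * Z).trace = ∑ i, ∑ j, Z i j ^ 2 := by
    simp only [Matrix.trace, Matrix.diag_apply]
    refine Finset.sum_congr rfl fun i _ => ?_
    rw [Matrix.mul_apply]
    refine Finset.sum_congr rfl fun j _ => ?_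
    rw [hZ i j]; ring
  have h5 : ∑ i, ∑ j, d i ^ 2 * Z i j ^ 2 = ∑ i, ∑ j, d j ^ 2 * Z i j ^ 2 := by
    rw [Finset.sum_comm]
    exact Finset.sum_congr rfl fun i _ => Finset.sum_congr rfl fun j _ => by rw [hZ i j]
  have h6 : ∑ i, ∑ j, (d i ^ 2 + d j ^ 2 - 2 * (d i * d j)) * Z i j ^ 2
      ≤ ∑ i, ∑ j, (2 * ∑ k, d k ^ 2) * Z i j ^ 2 := by
    refine Finset.sum_le_sum fun i _ => Finset.sum_le_sum fun j _ => ?_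
    refine mul_le_mul_of_nonneg_right ?_ (sq_nonneg _)
    by_cases hij : i = j
    · subst hij
      have : 0 ≤ ∑ k, d k ^ 2 := Finset.sum_nonneg fun k _ => sq_nonneg _
      nlinarith
    · have : d i ^ 2 + d j ^ 2 ≤ ∑ k, d k ^ 2 := by
        rw [← Finset.sum_pair (f := fun k => d k ^ 2) hij]
        exact Finset.sum_le_sum_of_subset_of_nonneg (Finset.subset_univ _)
          fun k _ _ => sq_nonneg _
      nlinarith [sq_nonneg (d i + d j)]
  have h7 : ∑ i, ∑ j, (d i ^ 2 + d j ^ 2 - 2 * (d i * d j)) * Z i j ^ 2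
      = ∑ i, ∑ j, d i ^ 2 * Z i j ^ 2 + ∑ i, ∑ j, d j ^ 2 * Z i j ^ 2
        - 2 * ∑ i, ∑ j, d i * d j * Z i j ^ 2 := by
    simp only [Finset.mul_sum, ← Finset.sum_add_distrib, ← Finset.sum_sub_distrib]
    exact Finset.sum_congr rfl fun i _ => Finset.sum_congr rfl fun j _ => by ring
  simp only [← Finset.mul_sum] at h6
  rw [h1, h2, h3, h4]
  linarith

theorem conj_bound_aux {n : ℕ} (U V D Y : Matrix (Fin n) (Fin n) ℝ) (hVU : V * U = 1)
    (hUV : U * V = 1)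
    (h : (D * D * (V * Y * U * (V * Y * U))).trace - (D * (V * Y * U) * (D * (V * Y * U))).trace
      ≤ (D * D).trace * (V * Y * U * (V * Y * U)).trace) :
    (U * D * V * (U * D * V) * (Y * Y)).trace - (U * D * V * Y * (U * D * V * Y)).trace
      ≤ (U * D * V * (U * D * V)).trace * (Y * Y).trace := by
  have c1 : ∀ A : Matrix (Fin n) (Fin n) ℝ, V * (U * A) = A := fun A => by
    rw [← Matrix.mul_assoc, hVU, Matrix.one_mul]
  have c2 : ∀ A : Matrix (Fin n) (Fin n) ℝ, U * (V * A) = A := fun A => by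
    rw [← Matrix.mul_assoc, hUV, Matrix.one_mul]
  have e : ∀ A : Matrix (Fin n) (Fin n) ℝ, (U * A).trace = (A * U).trace :=
    fun A => Matrix.trace_mul_comm _ _
  have e' : (Y * Y).trace = (V * (Y * (Y * U))).trace := by
    rw [Matrix.trace_mul_comm V]
    simp only [Matrix.mul_assoc, hUV, Matrix.mul_one]
  simp only [Matrix.mul_assoc, c1, c2] at h ⊢
  rw [e', e, e, e]
  simpa only [Matrix.mul_assoc, c1, c2, hVU, Matrix.mul_one] using h

/-- For symmetric `X, Y`: `tr(X²Y²) − tr((XY)²) ≤ tr(X²)·tr(Y²)`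
(the algebraic form of the curvature lower bound `−1/2`). -/
theorem trace_curvature_bound {n : ℕ} (X Y : Matrix (Fin n) (Fin n) ℝ)
    (hX : X.IsHermitian) (hY : Y.IsHermitian) :
    (X * X * (Y * Y)).trace - (X * Y * (X * Y)).trace
      ≤ (X * X).trace * (Y * Y).trace := by
  have hs : X = (hX.eigenvectorUnitary : Matrix (Fin n) (Fin n) ℝ) * diagonal hX.eigenvalues *
      star (hX.eigenvectorUnitary : Matrix (Fin n) (Fin n) ℝ) := by
    have := hX.spectral_theorem
    simpa [Unitary.conjStarAlgAut_apply] using this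
  generalize hX.eigenvalues = d at hs
  have hVU : star (hX.eigenvectorUnitary : Matrix (Fin n) (Fin n) ℝ) *
      (hX.eigenvectorUnitary : Matrix (Fin n) (Fin n) ℝ) = 1 :=
    Unitary.coe_star_mul_self hX.eigenvectorUnitary
  have hUV : (hX.eigenvectorUnitary : Matrix (Fin n) (Fin n) ℝ) *
      star (hX.eigenvectorUnitary : Matrix (Fin n) (Fin n) ℝ) = 1 :=
    Unitary.coe_mul_star_self hX.eigenvectorUnitary
  generalize (hX.eigenvectorUnitary : Matrix (Fin n) (Fin n) ℝ) = U at hs hVU hUV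
  rw [hs]
  refine conj_bound_aux U (star U) (diagonal d) Y hVU hUV (diag_bound_aux d _ ?_)
  have hZ : (star U * Y * U).IsHermitian := by
    rw [Matrix.star_eq_conjTranspose]
    exact Matrix.isHermitian_conjTranspose_mul_mul U hY
  intro i j
  simpa using hZ.apply i j
end

section
/- For every n ≥ 2, there exist real symmetric n×n matrices X and Y with tr(X²) = tr(Y²) = 1 and tr(XY) = 0 such that tr(X²Y²) − tr((XY)²) = 1. Hence the lower bound −1/2 in the inequality tr(X²Y²) − tr((XY)²) ≤ tr(X²)tr(Y²) (curvature bound K ≥ −1/2 for the trace metric on positive definite matrices) is attained and cannot be improved. -/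
open Matrix Real Filter

open SPD

/-- For `n ≥ 2` the curvature bound is attained: there exist symmetric `X, Y`
with `tr(X²) = tr(Y²) = 1`, `tr(XY) = 0` and `tr(X²Y²) − tr((XY)²) = 1`. -/
theorem curvature_bound_attained (n : ℕ) (hn : 2 ≤ n) :
    ∃ X Y : Matrix (Fin n) (Fin n) ℝ, X.IsHermitian ∧ Y.IsHermitian ∧
      (X * X).trace = 1 ∧ (Y * Y).trace = 1 ∧ (X * Y).trace = 0 ∧
      (X * X * (Y * Y)).trace - (X * Y * (X * Y)).trace = 1 := by
  have hc : (√2)⁻¹ * (√2)⁻¹ = (1 / 2 : ℝ) := by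
    rw [← mul_inv, Real.mul_self_sqrt (by norm_num)]; norm_num
  generalize (√2)⁻¹ = c at hc
  let i : Fin n := ⟨0, by omega⟩
  let j : Fin n := ⟨1, by omega⟩
  have hij : i ≠ j := by simp [i, j]
  have hji : j ≠ i := hij.symm
  clear_value i j
  refine ⟨single i i c - single j j c, single i j c + single j i c, ?_, ?_, ?_, ?_, ?_, ?_⟩
  · simp [Matrix.IsHermitian, conjTranspose_sub]
  · simp [Matrix.IsHermitian, conjTranspose_add, add_comm]
  · simp [mul_sub, sub_mul, hij, hji, hc]; try norm_num
  · simp [mul_add, add_mul, hij, hji, hc]; try norm_num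
  · simp [mul_add, sub_mul, hij, hji, hc]
  · simp [mul_add, add_mul, mul_sub, sub_mul, hij, hji, hc]; try norm_num
end
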